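/- W acts transitively on the set of 10-element subsets {c_1, d_1, c_2, d_2, c_3, d_3, c_4, d_4, c_5, d_5} of C consisting of 10 distinct exceptional classes such that B(c_i, c_j) = 1 for all i \neq j, B(c_i, d_i) = 3 for each i, B(c_i, d_j) = 1 for all i \neq j, and B(d_i, d_j) = 1 for all i \neq j (equivalently, on the 10-element cliques with weights in {1,3} containing exactly five pairs pairing to 3). -/

import Mathlib

/-- The intersection pairing on `ℤ⁹`, the Picard lattice of a del Pezzo surface of degree 1. -/
def B (v w : Fin 9 → ℤ) : ℤ := v 0 * w 0 - ∑ i : Fin 8, v i.succ * w i.succ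

/-- The canonical class `K = (-3, -1, …, -1)`. -/
def Kcl : Fin 9 → ℤ := fun i => if i = 0 then -3 else -1

/-- A vector is an exceptional class if `B(v,v) = -1` and `B(v,K) = -1`. -/
def IsExc (v : Fin 9 → ℤ) : Prop := B v v = -1 ∧ B v Kcl = -1

/-- The type of exceptional classes (the set `C`). -/
abbrev Exc : Type := {v : Fin 9 → ℤ // IsExc v}

/-- The pairing on exceptional classes. -/
def Bx (x y : Exc) : ℤ := B x.1 y.1

/-- `S` is a clique with weights in `M` if `B(x,y) ∈ M` for all distinct `x, y ∈ S`. -/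
def IsClique (M : Set ℤ) (S : Finset Exc) : Prop :=
  ∀ x ∈ S, ∀ y ∈ S, x ≠ y → Bx x y ∈ M

/-- A bijection of `C` preserving the pairing `B`: an element of the Weyl group `W`. -/
def PreservesB (g : Exc ≃ Exc) : Prop := ∀ x y : Exc, Bx (g x) (g y) = Bx x y

/-- Two finite subsets of `C` lie in the same orbit of `W`. -/
def SameOrbit (S T : Finset Exc) : Prop :=
  ∃ g : Exc ≃ Exc, PreservesB g ∧ S.image g = T

/-- `S` is a 10-element set `{c₁, d₁, …, c₅, d₅}` of 10 distinct exceptional classes with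
`B(cᵢ,cⱼ) = 1` for `i ≠ j`, `B(cᵢ,dᵢ) = 3` for all `i`, `B(cᵢ,dⱼ) = 1` for `i ≠ j`, and
`B(dᵢ,dⱼ) = 1` for `i ≠ j` (a 10-element clique with weights in `{1,3}` consisting of five
pairs pairing to 3). -/
def IsFivePairClique (S : Finset Exc) : Prop :=
  ∃ c d : Fin 5 → Exc,
    S = Finset.image c Finset.univ ∪ Finset.image d Finset.univ ∧
    S.card = 10 ∧
    (∀ i j : Fin 5, i ≠ j → Bx (c i) (c j) = 1) ∧
    (∀ i : Fin 5, Bx (c i) (d i) = 3) ∧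
    (∀ i j : Fin 5, i ≠ j → Bx (c i) (d j) = 1) ∧
    (∀ i j : Fin 5, i ≠ j → Bx (d i) (d j) = 1)

abbrev V9 : Type := Fin 9 → ℤ

lemma B_comm (v w : V9) : B v w = B w v := by
  simp only [B, mul_comm]

lemma B_add (v w x : V9) : B (v + w) x = B v x + B w x := by
  simp [B, Fin.sum_univ_succ]; ring

lemma B_smul (k : ℤ) (v x : V9) : B (k • v) x = k * B v x := by
  simp [B, Fin.sum_univ_succ]; ring

lemma B_sub (v w x : V9) : B (v - w) x = B v x - B w x := by
  simp [B, Fin.sum_univ_succ]; ring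

lemma B_add' (v w x : V9) : B x (v + w) = B x v + B x w := by
  rw [B_comm, B_add, B_comm v, B_comm w]

lemma B_smul' (k : ℤ) (v x : V9) : B x (k • v) = k * B x v := by
  rw [B_comm, B_smul, B_comm v]

lemma B_sub' (v w x : V9) : B x (v - w) = B x v - B x w := by
  rw [B_comm, B_sub, B_comm v, B_comm w]

lemma B_K (v : V9) : B v Kcl = -3 * v 0 + ∑ i : Fin 8, v i.succ := by
  simp [B, Kcl, Fin.sum_univ_succ]; ring

lemma B_KK : B Kcl Kcl = 1 := by
  simp [B_K, Kcl, Fin.sum_univ_succ]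

lemma B_nonpos (v : V9) (h : B v Kcl = 0) : B v v ≤ 0 ∧ (B v v = 0 → v = 0) := by
  rw [B_K] at h
  have hc := sq_sum_le_card_mul_sum_sq (s := (Finset.univ : Finset (Fin 8))) (f := fun i => v i.succ)
  simp only [Finset.card_univ, Fintype.card_fin] at hc
  have hs : ∑ i : Fin 8, v i.succ = 3 * v 0 := by linarith
  have hB : B v v = v 0 * v 0 - ∑ i : Fin 8, v i.succ ^ 2 := by simp [B, sq]
  rw [hs] at hc
  push_cast at hc
  refine ⟨by nlinarith [sq_nonneg (v 0)], fun h0 => ?_⟩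
  have h1 : v 0 = 0 := by
    have : v 0 ^ 2 ≤ 0 := by nlinarith
    exact pow_eq_zero_iff (n := 2) (by norm_num) |>.1 (le_antisymm this (sq_nonneg _))
  have h2 : ∑ i : Fin 8, v i.succ ^ 2 = 0 := by rw [h1] at hB; linarith
  rw [Finset.sum_eq_zero_iff_of_nonneg (fun _ _ => sq_nonneg _)] at h2
  funext i
  refine Fin.cases h1 (fun j => ?_) i
  simpa using h2 j (Finset.mem_univ _)

def Root (v : V9) : Prop := B v v = -2 ∧ B v Kcl = 0

def Good (g : V9 ≃ₗ[ℤ] V9) : Prop := (∀ v w, B (g v) (g w) = B v w) ∧ g Kcl = Kcl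

lemma Good.trans {g h : V9 ≃ₗ[ℤ] V9} (hg : Good g) (hh : Good h) : Good (g.trans h) :=
  ⟨fun v w => by simp [hg.1, hh.1], by simp [hg.2, hh.2]⟩

lemma Good.symm {g : V9 ≃ₗ[ℤ] V9} (hg : Good g) : Good g.symm :=
  ⟨fun v w => by rw [← hg.1]; simp, by rw [LinearEquiv.symm_apply_eq, hg.2]⟩

lemma Good.root {g : V9 ≃ₗ[ℤ] V9} (hg : Good g) {r : V9} (hr : Root r) : Root (g r) :=
  ⟨by rw [hg.1, hr.1], by rw [← hr.2, ← hg.1 r Kcl, hg.2]⟩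

def reflFun (α : V9) : V9 →ₗ[ℤ] V9 where
  toFun v := v + B v α • α
  map_add' v w := by rw [B_add, add_smul]; abel
  map_smul' k v := by rw [B_smul, RingHom.id_apply, smul_add, mul_smul]

lemma refl_exists (α : V9) (h : Root α) :
    ∃ g : V9 ≃ₗ[ℤ] V9, Good g ∧ ∀ v, g v = v + B v α • α := by
  have hinv : Function.Involutive (reflFun α) := by
    intro v
    simp only [reflFun, LinearMap.coe_mk, AddHom.coe_mk, B_add, B_smul, h.1]
    rw [add_assoc, ← add_smul]
    have : B v α + (B v α + B v α * -2) = 0 := by ring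
    rw [this, zero_smul, add_zero]
  refine ⟨LinearEquiv.ofInvolutive (reflFun α) hinv, ⟨?_, ?_⟩, fun v => rfl⟩
  · intro v w
    change B (v + B v α • α) (w + B w α • α) = _
    rw [B_add, B_add', B_add', B_smul, B_smul, B_smul', B_smul', h.1, B_comm α w]
    ring
  · change Kcl + B Kcl α • α = Kcl
    rw [B_comm, h.2, zero_smul, add_zero]

lemma step_neg (s : V9) (hs : Root s) :
    ∃ g : V9 ≃ₗ[ℤ] V9, Good g ∧ g (-s) = s ∧ ∀ v, B v s = 0 → g v = v := by
  obtain ⟨g, hg, h⟩ := refl_exists s hs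
  refine ⟨g, hg, ?_, fun v hv => by rw [h, hv]; simp⟩
  rw [map_neg, h, hs.1]
  module

lemma step1 (r s : V9) (hr : Root r) (hs : Root s) (h : B r s ≠ 0) :
    ∃ g : V9 ≃ₗ[ℤ] V9, Good g ∧ g r = s ∧ ∀ v, B v r = 0 → B v s = 0 → g v = v := by
  have hsr : B s r = B r s := B_comm _ _
  have hp := B_nonpos (r + s) (by rw [B_add, hr.2, hs.2]; rfl)
  have hm := B_nonpos (r - s) (by rw [B_sub, hr.2, hs.2]; rfl)
  have ep : B (r + s) (r + s) = 2 * B r s - 4 := by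
    rw [B_add, B_add', B_add', hr.1, hs.1, hsr]; ring
  have em : B (r - s) (r - s) = - 2 * B r s - 4 := by
    rw [B_sub, B_sub', B_sub', hr.1, hs.1, hsr]; ring
  rw [ep] at hp
  rw [em] at hm
  have h1 : B r s ≤ 2 := by linarith [hp.1]
  have h2 : -2 ≤ B r s := by linarith [hm.1]
  have hcases : B r s = 2 ∨ B r s = 1 ∨ B r s = -1 ∨ B r s = -2 := by omega
  rcases hcases with e | e | e | e
  · have : r + s = 0 := hp.2 (by rw [e]; rfl)
    have hrs : r = -s := eq_neg_of_add_eq_zero_left this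
    obtain ⟨g, hg, h3, h4⟩ := step_neg s hs
    exact ⟨g, hg, by rw [hrs, h3], fun v _ hv => h4 v hv⟩
  · obtain ⟨g, hg, h3⟩ := refl_exists (r + s)
      ⟨by rw [ep, e]; rfl, by rw [B_add, hr.2, hs.2]; rfl⟩
    obtain ⟨k, hk, h4, h5⟩ := step_neg s hs
    refine ⟨g.trans k, hg.trans hk, ?_, fun v hv hv' => ?_⟩
    · have : g r = -s := by
        rw [h3, B_add', hr.1, e]; module
      simp [this, -map_neg, h4]
    · have : g v = v := by rw [h3, B_add', hv, hv']; simp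
      simp [this, h5 v hv']
  · obtain ⟨g, hg, h3⟩ := refl_exists (r - s)
      ⟨by rw [em, e]; rfl, by rw [B_sub, hr.2, hs.2]; rfl⟩
    refine ⟨g, hg, ?_, fun v hv hv' => ?_⟩
    · rw [h3, B_sub', hr.1, e]; module
    · rw [h3, B_sub', hv, hv']; simp
  · have : r - s = 0 := hm.2 (by rw [e]; rfl)
    have hrs : r = s := sub_eq_zero.1 this
    exact ⟨LinearEquiv.refl ℤ _, ⟨fun _ _ => rfl, rfl⟩, by simpa using hrs, fun v _ _ => rfl⟩

/-! Enumeration of the roots. -/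

def en : ℕ → ℤ → ℤ → List (List ℤ)
  | 0, s, q => if s = 0 ∧ q = 0 then [[]] else []
  | n + 1, s, q => [-4, -3, -2, -1, 0, 1, 2, 3, 4].flatMap fun b =>
      if (s - b) * (s - b) ≤ n * (q - b * b) then (en n (s - b) (q - b * b)).map (b :: ·) else []

def ssq : List ℤ → ℤ
  | [] => 0
  | b :: l => b * b + ssq l

def ssum : List ℤ → ℤ
  | [] => 0
  | b :: l => b + ssum l

lemma ssq_nonneg (l : List ℤ) : 0 ≤ ssq l := by
  induction l with
  | nil => simp [ssq]
  | cons b l ih => simp only [ssq]; nlinarith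

lemma cauchy_aux (m t : ℤ) (l : List ℤ) :
    0 ≤ m * m * ssq l - 2 * m * t * ssum l + l.length * (t * t) := by
  induction l with
  | nil => simp [ssq, ssum]
  | cons b l ih =>
    simp only [ssq, ssum, List.length_cons]
    push_cast
    nlinarith [sq_nonneg (m * b - t)]

lemma cauchy_list (l : List ℤ) : ssum l * ssum l ≤ l.length * ssq l := by
  cases l with
  | nil => simp [ssq, ssum]
  | cons b l =>
    have h := cauchy_aux ((b :: l).length) (ssum (b :: l)) (b :: l)
    have hp : (0 : ℤ) < ((b :: l).length : ℤ) := by simp only [List.length_cons]; omega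
    by_contra hc
    push Not at hc
    nlinarith

lemma mem_en (l : List ℤ) (h : ssq l ≤ 18) : l ∈ en l.length (ssum l) (ssq l) := by
  induction l with
  | nil => simp [en, ssum, ssq]
  | cons b l ih =>
    have h0 := ssq_nonneg l
    simp only [ssq] at h
    have hb1 : b ≤ 4 := by nlinarith
    have hb2 : -4 ≤ b := by nlinarith
    simp only [en, List.length_cons, List.mem_flatMap]
    refine ⟨b, ?_, ?_⟩
    · interval_cases b <;> simp
    · have e1 : ssum (b :: l) - b = ssum l := by simp [ssum]
      have e2 : ssq (b :: l) - b * b = ssq l := by simp [ssq]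
      rw [e1, e2, if_pos (cauchy_list l)]
      exact List.mem_map_of_mem (ih (by nlinarith))

def rootsL : List (List ℤ) :=
  [-4, -3, -2, -1, 0, 1, 2, 3, 4].flatMap fun a => (en 8 (3 * a) (a * a + 2)).map (a :: ·)

lemma mem_rootsL (r : V9) (hr : Root r) : List.ofFn r ∈ rootsL := by
  obtain ⟨h1, h2⟩ := hr
  rw [B_K] at h2
  have hl : List.ofFn r = r 0 :: List.ofFn (fun i : Fin 8 => r i.succ) := by
    rw [List.ofFn_succ]
  have es : ssum (List.ofFn (fun i : Fin 8 => r i.succ)) = 3 * r 0 := by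
    simp [List.ofFn_succ, ssum, Fin.sum_univ_succ] at h2 ⊢
    linarith
  have eq : ssq (List.ofFn (fun i : Fin 8 => r i.succ)) = r 0 * r 0 + 2 := by
    simp [B, List.ofFn_succ, ssq, Fin.sum_univ_succ] at h1 ⊢
    linarith
  have hc := cauchy_list (List.ofFn (fun i : Fin 8 => r i.succ))
  rw [es, eq, List.length_ofFn] at hc
  push_cast at hc
  have ha : r 0 * r 0 ≤ 16 := by nlinarith
  have hb1 : r 0 ≤ 4 := by nlinarith
  have hb2 : -4 ≤ r 0 := by nlinarith
  have hm := mem_en (List.ofFn (fun i : Fin 8 => r i.succ)) (by rw [eq]; linarith)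
  rw [es, eq, List.length_ofFn] at hm
  rw [hl, rootsL, List.mem_flatMap]
  refine ⟨r 0, ?_, List.mem_map_of_mem hm⟩
  generalize r 0 = a at hb1 hb2
  interval_cases a <;> simp

def dot : List ℤ → List ℤ → ℤ
  | a :: l, b :: m => a * b + dot l m
  | _, _ => 0

def LB : List ℤ → List ℤ → ℤ
  | a :: l, b :: m => a * b - dot l m
  | _, _ => 0

lemma LB_ofFn (v w : V9) : LB (List.ofFn v) (List.ofFn w) = B v w := by
  simp [List.ofFn_succ, LB, dot, B, Fin.sum_univ_succ]

/-- `l` orthogonal to everything in `L`. -/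
def orthL (L : List (List ℤ)) (l : List ℤ) : Bool := L.all fun x => LB x l == 0

def chk (L W : List (List ℤ)) (t : List ℤ) : Bool :=
  rootsL.all fun l => !(orthL L l) || LB l t != 0 || W.any fun s => LB l s != 0

lemma orthL_of (L : List V9) (r : V9) (h : ∀ v ∈ L, B v r = 0) :
    orthL (L.map (List.ofFn ·)) (List.ofFn r) = true := by
  simp only [orthL, List.all_map, List.all_eq_true, Function.comp, beq_iff_eq, LB_ofFn]
  exact h

lemma stage (L W : List V9) (t : V9)
    (hc : chk (L.map (List.ofFn ·)) (W.map (List.ofFn ·)) (List.ofFn t) = true)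
    (ht : Root t) (htL : ∀ v ∈ L, B v t = 0)
    (hW : ∀ s ∈ W, (B s s = -2 ∧ B s Kcl = 0) ∧ B s t ≠ 0 ∧ ∀ v ∈ L, B v s = 0)
    (r : V9) (hr : Root r) (hrL : ∀ v ∈ L, B v r = 0) :
    ∃ g : V9 ≃ₗ[ℤ] V9, Good g ∧ g r = t ∧ ∀ v ∈ L, g v = v := by
  rw [chk, List.all_eq_true] at hc
  have h := hc _ (mem_rootsL r hr)
  rw [orthL_of L r hrL] at h
  simp only [Bool.not_true, Bool.false_or, Bool.or_eq_true, bne_iff_ne, List.any_map,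
    List.any_eq_true, Function.comp, LB_ofFn] at h
  rcases h with h | ⟨s, hs, h⟩
  · obtain ⟨g, hg, h1, h2⟩ := step1 r t hr ht h
    exact ⟨g, hg, h1, fun v hv => h2 v (hrL v hv) (htL v hv)⟩
  · obtain ⟨hs1, hs2, hs3⟩ := hW s hs
    obtain ⟨g, hg, h1, h2⟩ := step1 r s hr hs1 h
    obtain ⟨k, hk, h3, h4⟩ := step1 s t hs1 ht hs2
    refine ⟨g.trans k, hg.trans hk, by simp [h1, h3], fun v hv => ?_⟩
    simp [h2 v (hrL v hv) (hs3 v hv), h4 v (hs3 v hv) (htL v hv)]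

def p1 : V9 := ![0,1,-1,0,0,0,0,0,0]
def p2 : V9 := ![0,0,0,1,-1,0,0,0,0]
def p3 : V9 := ![1,1,1,0,0,1,0,0,0]
def p4 : V9 := ![1,0,0,1,1,1,0,0,0]
def p5 : V9 := ![0,0,0,0,0,0,1,-1,0]

lemma stage_1 (r : V9) (hr : Root r) : ∃ g : V9 ≃ₗ[ℤ] V9, Good g ∧ g r = p1 := by
  obtain ⟨g, hg, h, -⟩ := stage [] [![-3, -2, -1, -1, -1, -1, -1, -1, -1],
    ![-2, -1, 0, -1, -1, -1, -1, -1, 0], ![-2, -1, 0, -1, -1, -1, -1, 0, -1],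
    ![-2, -1, 0, -1, -1, -1, 0, -1, -1], ![-2, -1, 0, -1, -1, 0, -1, -1, -1],
    ![-2, -1, 0, -1, 0, -1, -1, -1, -1]] p1 (by decide +kernel)
    (by unfold Root; decide +kernel) (by decide +kernel) (by decide +kernel) r hr (by simp)
  exact ⟨g, hg, h⟩

lemma stage_2 (r : V9) (hr : Root r) (h1 : B p1 r = 0) :
    ∃ g : V9 ≃ₗ[ℤ] V9, Good g ∧ g r = p2 ∧ g p1 = p1 := by
  obtain ⟨g, hg, h, h'⟩ := stage [p1] [![-3, -1, -1, -2, -1, -1, -1, -1, -1],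
    ![-2, -1, -1, -1, 0, -1, -1, -1, 0], ![-2, -1, -1, -1, 0, -1, -1, 0, -1],
    ![-2, -1, -1, -1, 0, -1, 0, -1, -1], ![-2, -1, -1, -1, 0, 0, -1, -1, -1]] p2
    (by decide +kernel)
    (by unfold Root; decide +kernel) (by decide +kernel) (by decide +kernel) r hr (by simpa using h1)
  exact ⟨g, hg, h, h' _ (by simp)⟩

lemma stage_3 (r : V9) (hr : Root r) (h1 : B p1 r = 0) (h2 : B p2 r = 0) :
    ∃ g : V9 ≃ₗ[ℤ] V9, Good g ∧ g r = p3 ∧ g p1 = p1 ∧ g p2 = p2 := by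
  obtain ⟨g, hg, h, h'⟩ := stage [p1, p2] [![-3, -1, -1, -1, -1, -2, -1, -1, -1],
    ![-2, -1, -1, -1, -1, -1, -1, 0, 0], ![-2, -1, -1, -1, -1, -1, 0, -1, 0]] p3
    (by decide +kernel)
    (by unfold Root; decide +kernel) (by decide +kernel) (by decide +kernel) r hr
    (by simpa using ⟨h1, h2⟩)
  exact ⟨g, hg, h, h' _ (by simp), h' _ (by simp)⟩

lemma stage_5 (r : V9) (hr : Root r) (h1 : B p1 r = 0) (h2 : B p2 r = 0) (h3 : B p3 r = 0)
    (h4 : B p4 r = 0) :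
    ∃ g : V9 ≃ₗ[ℤ] V9, Good g ∧ g r = p5 ∧ g p1 = p1 ∧ g p2 = p2 ∧ g p3 = p3 ∧ g p4 = p4 := by
  obtain ⟨g, hg, h, h'⟩ := stage [p1, p2, p3, p4] [![-3, -1, -1, -1, -1, -1, -2, -1, -1]] p5
    (by decide +kernel)
    (by unfold Root; decide +kernel) (by decide +kernel) (by decide +kernel) r hr
    (by simpa using ⟨h1, h2, h3, h4⟩)
  exact ⟨g, hg, h, h' _ (by simp), h' _ (by simp), h' _ (by simp), h' _ (by simp)⟩

def Ev4 (a b c d : V9) : Prop := ∃ w : V9, a + b + c + d = (2 : ℤ) • w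

lemma Ev4.map {a b c d : V9} (h : Ev4 a b c d) (g : V9 ≃ₗ[ℤ] V9) :
    Ev4 (g a) (g b) (g c) (g d) := by
  obtain ⟨w, hw⟩ := h
  exact ⟨g w, by rw [← map_smul, ← hw]; simp⟩

lemma Ev4.of_map {a b c d : V9} (g : V9 ≃ₗ[ℤ] V9) (h : Ev4 (g a) (g b) (g c) (g d)) :
    Ev4 a b c d := by
  simpa using h.map g.symm

def evL : List ℤ → List ℤ → List ℤ → List ℤ → Bool
  | a :: as, b :: bs, c :: cs, d :: ds => (a + b + c + d) % 2 == 0 && evL as bs cs ds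
  | _, _, _, _ => true

lemma evL_iff (a b c d : V9) :
    evL (List.ofFn a) (List.ofFn b) (List.ofFn c) (List.ofFn d) = true ↔ Ev4 a b c d := by
  have h1 : Ev4 a b c d ↔ ∀ i, (a i + b i + c i + d i) % 2 = 0 := by
    constructor
    · rintro ⟨w, hw⟩ i
      have := congrFun hw i
      simp at this
      omega
    · intro h
      refine ⟨fun i => (a i + b i + c i + d i) / 2, ?_⟩
      funext i
      have := h i
      simp
      omega
  rw [h1]
  simp [List.ofFn_succ, evL, Fin.forall_fin_succ]

def chk4 (a b c q : List ℤ) : Bool :=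
  rootsL.all fun l => !(orthL [a, b, c] l) || !(evL a b c l) || LB l q != 0

def chkB (a b c : List ℤ) : Bool :=
  (rootsL.filter (orthL [a, b, c])).all fun l => (rootsL.filter (orthL [a, b, c])).all fun m =>
    LB l m != 0 || evL m b c l || evL a m c l || evL a b m l || evL a b c m || evL a b c l

lemma chk4_true : chk4 (List.ofFn p1) (List.ofFn p2) (List.ofFn p3) (List.ofFn p4) = true := by
  decide +kernel

lemma chkB_true : chkB (List.ofFn p1) (List.ofFn p2) (List.ofFn p3) = true := by
  decide +kernel

lemma stage_4 (r : V9) (hr : Root r) (h1 : B p1 r = 0) (h2 : B p2 r = 0) (h3 : B p3 r = 0)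
    (he : Ev4 p1 p2 p3 r) :
    ∃ g : V9 ≃ₗ[ℤ] V9, Good g ∧ g r = p4 ∧ g p1 = p1 ∧ g p2 = p2 ∧ g p3 = p3 := by
  have hc := chk4_true
  rw [chk4, List.all_eq_true] at hc
  have h := hc _ (mem_rootsL r hr)
  have ho := orthL_of [p1, p2, p3] r (by simpa using ⟨h1, h2, h3⟩)
  simp only [List.map] at ho
  rw [ho, (evL_iff _ _ _ _).2 he] at h
  simp only [Bool.not_true, Bool.false_or, bne_iff_ne, LB_ofFn] at h
  obtain ⟨g, hg, h4, h5⟩ := step1 r p4 hr (by unfold Root; decide +kernel) h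
  exact ⟨g, hg, h4, h5 _ h1 (by decide +kernel), h5 _ h2 (by decide +kernel),
    h5 _ h3 (by decide +kernel)⟩

lemma three (a b c : V9) (ha : Root a) (hb : Root b) (hc : Root c)
    (hab : B a b = 0) (hac : B a c = 0) (hbc : B b c = 0) :
    ∃ g : V9 ≃ₗ[ℤ] V9, Good g ∧ g a = p1 ∧ g b = p2 ∧ g c = p3 := by
  obtain ⟨g, hg, g1⟩ := stage_1 a ha
  obtain ⟨h, hh, h2, h1⟩ := stage_2 (g b) (hg.root hb) (by rw [← g1, hg.1, hab])
  obtain ⟨k, hk, k3, k1, k2⟩ := stage_3 (h (g c)) (hh.root (hg.root hc))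
    (by rw [← h1, hh.1, ← g1, hg.1, hac]) (by rw [← h2, hh.1, hg.1, hbc])
  refine ⟨(g.trans h).trans k, (hg.trans hh).trans hk, ?_, ?_, ?_⟩ <;> simp [*]

lemma five (r : Fin 5 → V9) (hr : ∀ i, Root (r i)) (ho : ∀ i j, i ≠ j → B (r i) (r j) = 0)
    (he : Ev4 (r 0) (r 1) (r 2) (r 3)) :
    ∃ g : V9 ≃ₗ[ℤ] V9, Good g ∧ ∀ i, g (r i) = ![p1, p2, p3, p4, p5] i := by
  obtain ⟨g, hg, g1, g2, g3⟩ := three (r 0) (r 1) (r 2) (hr _) (hr _) (hr _)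
    (ho _ _ (by decide)) (ho _ _ (by decide)) (ho _ _ (by decide))
  have he' := he.map g
  rw [g1, g2, g3] at he'
  obtain ⟨h, hh, h4, h1, h2, h3⟩ := stage_4 (g (r 3)) (hg.root (hr _))
    (by rw [← g1, hg.1, ho _ _ (by decide)]) (by rw [← g2, hg.1, ho _ _ (by decide)])
    (by rw [← g3, hg.1, ho _ _ (by decide)]) he'
  obtain ⟨k, hk, k5, k1, k2, k3, k4⟩ := stage_5 (h (g (r 4))) (hh.root (hg.root (hr _)))
    (by rw [← h1, hh.1, ← g1, hg.1, ho _ _ (by decide)])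
    (by rw [← h2, hh.1, ← g2, hg.1, ho _ _ (by decide)])
    (by rw [← h3, hh.1, ← g3, hg.1, ho _ _ (by decide)])
    (by rw [← h4, hh.1, hg.1, ho _ _ (by decide)])
  refine ⟨(g.trans h).trans k, (hg.trans hh).trans hk, ?_⟩
  intro i
  fin_cases i <;> simp [*]

lemma block (r : Fin 5 → V9) (hr : ∀ i, Root (r i)) (ho : ∀ i j, i ≠ j → B (r i) (r j) = 0) :
    ∃ σ : Equiv.Perm (Fin 5), Ev4 (r (σ 0)) (r (σ 1)) (r (σ 2)) (r (σ 3)) := by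
  obtain ⟨g, hg, g1, g2, g3⟩ := three (r 0) (r 1) (r 2) (hr _) (hr _) (hr _)
    (ho _ _ (by decide)) (ho _ _ (by decide)) (ho _ _ (by decide))
  have hmem : ∀ i, i ≠ 0 → i ≠ 1 → i ≠ 2 → List.ofFn (g (r i)) ∈
      rootsL.filter (orthL [List.ofFn p1, List.ofFn p2, List.ofFn p3]) := by
    intro i i0 i1 i2
    rw [List.mem_filter]
    refine ⟨mem_rootsL _ (hg.root (hr _)), orthL_of [p1, p2, p3] _ ?_⟩
    simp only [List.mem_cons, List.not_mem_nil, or_false, forall_eq_or_imp, forall_eq]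
    exact ⟨by rw [← g1, hg.1, ho _ _ i0.symm], by rw [← g2, hg.1, ho _ _ i1.symm],
      by rw [← g3, hg.1, ho _ _ i2.symm]⟩
  have hc := chkB_true
  rw [chkB, List.all_eq_true] at hc
  have h := hc _ (hmem 3 (by decide) (by decide) (by decide))
  rw [List.all_eq_true] at h
  have h' := h _ (hmem 4 (by decide) (by decide) (by decide))
  simp only [Bool.or_eq_true, bne_iff_ne, LB_ofFn, evL_iff] at h'
  rw [hg.1, ho _ _ (by decide)] at h'
  simp only [ne_eq, not_true_eq_false, false_or] at h'
  rw [← g1, ← g2, ← g3] at h'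
  rcases h' with (((h' | h') | h') | h') | h'
  · exact ⟨Equiv.swap 0 4, h'.of_map g⟩
  · exact ⟨Equiv.swap 1 4, h'.of_map g⟩
  · exact ⟨Equiv.swap 2 4, h'.of_map g⟩
  · exact ⟨Equiv.swap 3 4, h'.of_map g⟩
  · exact ⟨1, h'.of_map g⟩

lemma root_of_exc (x : Exc) : Root (x.1 + Kcl) := by
  obtain ⟨h1, h2⟩ := x.2
  constructor
  · rw [B_add, B_add', B_add', h1, h2, B_comm Kcl, h2, B_KK]; rfl
  · rw [B_add, h2, B_KK]; rfl

lemma B_shift (x y : Exc) : B (x.1 + Kcl) (y.1 + Kcl) = Bx x y - 1 := by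
  rw [B_add, B_add', B_add', x.2.2, B_comm Kcl, y.2.2, B_KK, Bx]; ring

lemma opp (x y : Exc) (h : Bx x y = 3) : y.1 = - x.1 - (2 : ℤ) • Kcl := by
  have hx := root_of_exc x
  have hy := root_of_exc y
  have h0 := (B_nonpos ((x.1 + Kcl) + (y.1 + Kcl)) (by rw [B_add, hx.2, hy.2]; rfl)).2
    (by rw [B_add, B_add' (x.1 + Kcl) (y.1 + Kcl), B_add' (x.1 + Kcl) (y.1 + Kcl), hx.1, hy.1,
      B_comm (y.1 + Kcl), B_shift, h]; rfl)
  rw [← sub_eq_zero, ← h0]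
  module

lemma normal (c : Fin 5 → Exc) (hc : ∀ i j : Fin 5, i ≠ j → Bx (c i) (c j) = 1) :
    ∃ (g : V9 ≃ₗ[ℤ] V9) (σ : Equiv.Perm (Fin 5)), Good g ∧
      ∀ i, g ((c (σ i)).1 + Kcl) = ![p1, p2, p3, p4, p5] i := by
  have hr : ∀ i, Root ((c i).1 + Kcl) := fun i => root_of_exc _
  have ho : ∀ i j, i ≠ j → B ((c i).1 + Kcl) ((c j).1 + Kcl) = 0 := fun i j hij => by
    rw [B_shift, hc i j hij]; rfl
  obtain ⟨σ, hσ⟩ := block (fun i => (c i).1 + Kcl) hr ho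
  obtain ⟨g, hg, h⟩ := five (fun i => (c (σ i)).1 + Kcl) (fun i => hr _)
    (fun i j hij => ho _ _ (fun h => hij (σ.injective h))) hσ
  exact ⟨g, σ, hg, h⟩

lemma Good.exc {g : V9 ≃ₗ[ℤ] V9} (hg : Good g) (x : Exc) : IsExc (g x.1) :=
  ⟨by rw [hg.1, x.2.1], by rw [← x.2.2, ← hg.1 x.1 Kcl, hg.2]⟩

def excEquiv (g : V9 ≃ₗ[ℤ] V9) (hg : Good g) : Exc ≃ Exc where
  toFun x := ⟨g x.1, hg.exc x⟩
  invFun x := ⟨g.symm x.1, hg.symm.exc x⟩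
  left_inv x := by simp
  right_inv x := by simp

/-- `W` acts transitively on the set of 10-element subsets `{c₁, d₁, …, c₅, d₅}` of `C` as
above. -/
theorem stmt6 (S T : Finset Exc) (hS : IsFivePairClique S) (hT : IsFivePairClique T) :
    SameOrbit S T := by
  obtain ⟨c, d, hS, -, hcc, hcd, -, -⟩ := hS
  obtain ⟨c', d', hT, -, hcc', hcd', -, -⟩ := hT
  obtain ⟨g, σ, hg, h⟩ := normal c hcc
  obtain ⟨g', σ', hg', h'⟩ := normal c' hcc'
  have hk : Good (g.trans g'.symm) := hg.trans hg'.symm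
  set k := g.trans g'.symm with hkdef
  let π : Equiv.Perm (Fin 5) := σ.symm.trans σ'
  have h1 : ∀ i, k (c i).1 = (c' (π i)).1 := by
    intro i
    have e1 := h (σ.symm i)
    have e2 := h' (σ.symm i)
    rw [Equiv.apply_symm_apply] at e1
    have e3 : k ((c i).1 + Kcl) = (c' (π i)).1 + Kcl := by
      rw [hkdef, LinearEquiv.trans_apply, e1, ← e2, LinearEquiv.symm_apply_apply]
      rfl
    rw [map_add, hk.2] at e3
    exact add_right_cancel e3
  have h2 : ∀ i, k (d i).1 = (d' (π i)).1 := by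
    intro i
    rw [opp _ _ (hcd i), opp _ _ (hcd' (π i)), map_sub, map_neg, map_smul, hk.2, h1]
  refine ⟨excEquiv k hk, fun x y => hk.1 _ _, ?_⟩
  have f1 : (excEquiv k hk) ∘ c = c' ∘ π := funext fun i => Subtype.ext (h1 i)
  have f2 : (excEquiv k hk) ∘ d = d' ∘ π := funext fun i => Subtype.ext (h2 i)
  rw [hS, hT, Finset.image_union, Finset.image_image, Finset.image_image, f1, f2,
    ← Finset.image_image, ← Finset.image_image, Finset.image_univ_equiv]
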